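/- Let n ≥ 3 and x ∈ Λ_n with x = b/d in lowest terms, and let p̃_{n,x} ∈ C_q^s(n,2) be the correlation induced by the canonical strategy. Then p̃_{n,x} is an extreme point of the convex set C_q(n,2). -/

import Mathlib

open scoped Matrix Kronecker ComplexOrder

noncomputable section
namespace QST

/-- Euclidean norm of a finite complex vector. -/
def evnorm {ι : Type} [Fintype ι] (v : ι → ℂ) : ℝ :=
  Real.sqrt (∑ i, ‖v i‖ ^ 2)

/-- Inner product `⟨v, w⟩`, linear in the first argument. -/
def pinner {ι : Type} [Fintype ι] (v w : ι → ℂ) : ℂ :=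
  ∑ i, v i * (starRingEnd ℂ) (w i)

/-- Reduced density matrix of `ψψ*` on the first tensor factor. -/
def rhoA {dA dB : ℕ} (ψ : Fin dA × Fin dB → ℂ) : Matrix (Fin dA) (Fin dA) ℂ :=
  Matrix.of fun a a' => ∑ b, ψ (a, b) * (starRingEnd ℂ) (ψ (a', b))

/-- Reduced density matrix of `ψψ*` on the second tensor factor. -/
def rhoB {dA dB : ℕ} (ψ : Fin dA × Fin dB → ℂ) : Matrix (Fin dB) (Fin dB) ℂ :=
  Matrix.of fun b b' => ∑ a, ψ (a, b) * (starRingEnd ℂ) (ψ (a, b'))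

/-- The state-dependent seminorm `‖X‖_ρ = (tr (X* X ρ))^(1/2)`. -/
def rnorm {d : ℕ} (ρ X : Matrix (Fin d) (Fin d) ℂ) : ℝ :=
  Real.sqrt ((Xᴴ * X * ρ).trace).re

/-- Operator (spectral) norm of a matrix. -/
def opNorm {d : ℕ} (X : Matrix (Fin d) (Fin d) ℂ) : ℝ :=
  ‖Matrix.toEuclideanCLM (𝕜 := ℂ) X‖

/-- `P = P* = P²`. -/
def IsProjection {d : ℕ} (P : Matrix (Fin d) (Fin d) ℂ) : Prop :=
  Pᴴ = P ∧ P * P = P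

/-- 1-norm distance between correlations. -/
def dist1 {n k : ℕ} (p q : Fin n → Fin n → Fin k → Fin k → ℝ) : ℝ :=
  ∑ v, ∑ w, ∑ i, ∑ j, |p v w i j - q v w i j|

/-- Membership in the set `C_q(n,k)` of quantum correlations. -/
def IsQuantumCorrelation (n k : ℕ) (p : Fin n → Fin n → Fin k → Fin k → ℝ) : Prop :=
  ∃ (dA dB : ℕ) (ψ : Fin dA × Fin dB → ℂ)
    (E : Fin n → Fin k → Matrix (Fin dA) (Fin dA) ℂ)
    (F : Fin n → Fin k → Matrix (Fin dB) (Fin dB) ℂ),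
    evnorm ψ = 1 ∧ (∀ v i, (E v i).PosSemidef) ∧ (∀ v, ∑ i, E v i = 1) ∧
    (∀ w j, (F w j).PosSemidef) ∧ (∀ w, ∑ j, F w j = 1) ∧
    ∀ v w i j, (p v w i j : ℂ) = pinner ((E v i ⊗ₖ F w j).mulVec ψ) ψ

/-- Strategy 1 (the "tilde" strategy) is a local `ε`-dilation of strategy 2. -/
def IsLocalDilation {n k : ℕ} (ε : ℝ) {d1A d1B d2A d2B : ℕ}
    (ψ1 : Fin d1A × Fin d1B → ℂ)
    (E1 : Fin n → Fin k → Matrix (Fin d1A) (Fin d1A) ℂ)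
    (F1 : Fin n → Fin k → Matrix (Fin d1B) (Fin d1B) ℂ)
    (ψ2 : Fin d2A × Fin d2B → ℂ)
    (E2 : Fin n → Fin k → Matrix (Fin d2A) (Fin d2A) ℂ)
    (F2 : Fin n → Fin k → Matrix (Fin d2B) (Fin d2B) ℂ) : Prop :=
  ∃ (kA kB : ℕ) (VA : Matrix (Fin d1A × Fin kA) (Fin d2A) ℂ)
    (VB : Matrix (Fin d1B × Fin kB) (Fin d2B) ℂ) (χ : Fin kA × Fin kB → ℂ),
    VAᴴ * VA = 1 ∧ VBᴴ * VB = 1 ∧ evnorm χ = 1 ∧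
    evnorm (fun y : (Fin d1A × Fin d1B) × (Fin kA × Fin kB) =>
        ((VA ⊗ₖ VB).mulVec ψ2) ((y.1.1, y.2.1), (y.1.2, y.2.2)) - ψ1 y.1 * χ y.2) ≤ ε ∧
    ∀ (v w : Fin n) (i j : Fin k),
      evnorm (fun y : (Fin d1A × Fin d1B) × (Fin kA × Fin kB) =>
        ((VA ⊗ₖ VB).mulVec ((E2 v i ⊗ₖ F2 w j).mulVec ψ2)) ((y.1.1, y.2.1), (y.1.2, y.2.2))
          - ((E1 v i ⊗ₖ F1 w j).mulVec ψ1) y.1 * χ y.2) ≤ ε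

/-- The sequence generating `Λ_n` for `n ≥ 4`. -/
def lambdaSeq (n : ℕ) : ℕ → ℝ
  | 0 => 0
  | l + 1 => 1 + 1 / ((n : ℝ) - 1 - lambdaSeq n l)

/-- The sets `Λ_n`. -/
def Lambda (n : ℕ) : Set ℝ :=
  if n = 3 then {3 / 2} else Set.range (lambdaSeq n)

/-- The maximally entangled state `φ_d`. -/
def phid (d : ℕ) : Fin d × Fin d → ℂ :=
  fun y => if y.1 = y.2 then (((Real.sqrt d)⁻¹ : ℝ) : ℂ) else 0

/-- The two-outcome measurement `{M, 1 - M}`. -/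
def canonPair {d : ℕ} (M : Matrix (Fin d) (Fin d) ℂ) : Fin 2 → Matrix (Fin d) (Fin d) ℂ :=
  fun i => if i = 0 then M else 1 - M

def Det (n : ℕ) (y : ℂ) : Prop :=
  ∃ (a : Fin n → ℂ) (c : Fin n → Fin n → ℂ), ∀ (A : Type) [Ring A] [Algebra ℂ A]
    [FiniteDimensional ℂ A] (τ : A →ₗ[ℂ] ℂ) (_ : ∀ a b, τ (a * b) = τ (b * a)) (r : A)
    (P : Fin n → A) (_ : r * r = r) (_ : ∀ v, r * P v = P v) (_ : ∀ v, P v * r = P v)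
    (_ : ∀ v, P v * P v = P v) (_ : ∑ v, P v = y • r),
    (∀ v, τ (P v) = a v * τ r) ∧ ∀ v w, τ (P v * P w) = c v w * τ r

lemma idem_sum_zero {n : ℕ} (A : Type) [Ring A] [Algebra ℂ A]
    [FiniteDimensional ℂ A] (P : Fin n → A) (hP : ∀ v, P v * P v = P v)
    (hs : ∑ v, P v = 0) (v : Fin n) : P v = 0 := by
  have h1 : ∀ v, LinearMap.trace ℂ A (LinearMap.mulLeft ℂ (P v)) =
      (Module.finrank ℂ (LinearMap.range (LinearMap.mulLeft ℂ (P v))) : ℂ) := by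
    intro v
    apply LinearMap.IsProj.trace
    constructor
    · intro x; exact ⟨x, rfl⟩
    · rintro _ ⟨x, rfl⟩
      simp [← mul_assoc, hP]
  have h2 : ∑ v, LinearMap.mulLeft ℂ (P v) = 0 := by
    ext x
    simp [LinearMap.sum_apply, ← Finset.sum_mul, hs]
  have h3 : ∑ v, (Module.finrank ℂ (LinearMap.range (LinearMap.mulLeft ℂ (P v))) : ℂ) = 0 := by
    rw [← Finset.sum_congr rfl (fun v _ => h1 v), ← map_sum, h2, map_zero]
  have h4 : ∑ v, Module.finrank ℂ (LinearMap.range (LinearMap.mulLeft ℂ (P v))) = 0 := by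
    exact_mod_cast h3
  have h5 := (Finset.sum_eq_zero_iff.1 h4) v (Finset.mem_univ _)
  have h6 := Submodule.finrank_eq_zero.1 h5
  have h7 := LinearMap.range_eq_bot.1 h6
  have := LinearMap.congr_fun h7 1
  simpa using this

lemma det_zero (n : ℕ) : Det n 0 := by
  refine ⟨0, 0, ?_⟩
  intro A _ _ _ τ hτ r P hr h1 h2 h3 hs
  have := idem_sum_zero A P h3 (by simpa using hs)
  simp [this]

lemma det_step (n : ℕ) (x y : ℂ) (hx0 : x ≠ 0) (hx1 : x - 1 ≠ 0)
    (hxy : x / (x - 1) = n - y) (H : Det n y) : Det n x := by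
  obtain ⟨a, c, H⟩ := H
  refine ⟨fun v => (1 - a v) * (x - 1), fun v w => if v = w then (1 - a v) * (x - 1) else
    (c v w - 1 + (1 - a v) + (1 - a w)) * (x - 1) ^ 3, ?_⟩
  intro A _ _ _ τ hτ r P hr h1 h2 h3 hs
  let σ : Matrix (Fin n) (Fin n) A →ₗ[ℂ] ℂ := τ ∘ₗ Matrix.traceLinearMap (Fin n) ℂ A
  have hσdef : ∀ M, σ M = ∑ i, τ (M i i) := by
    intro M; simp [σ, Matrix.trace]
  have hσ : ∀ M N, σ (M * N) = σ (N * M) := by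
    intro M N
    simp only [hσdef, Matrix.mul_apply, map_sum]
    rw [Finset.sum_comm]
    simp only [hτ]
  let D : Matrix (Fin n) (Fin n) A := Matrix.diagonal P
  let K : Matrix (Fin n) (Fin n) A := Matrix.of fun v w => P v * P w
  let e : Fin n → Matrix (Fin n) (Fin n) A := fun v => Matrix.single v v (P v)
  have hDD : D * D = D := by simp [D, h3]
  have hDK : D * K = K := by
    ext v w; simp [D, K, Matrix.diagonal_mul, ← mul_assoc, h3]
  have hKD : K * D = K := by
    ext v w; simp [D, K, Matrix.mul_diagonal, mul_assoc, h3]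
  have hKK : K * K = x • K := by
    ext v w
    simp only [K, Matrix.mul_apply, Matrix.of_apply, Matrix.smul_apply]
    have : ∀ u, P v * P u * (P u * P w) = P v * (P u * P w) := by
      intro u; rw [mul_assoc, ← mul_assoc (P u), h3]
    simp only [this]
    rw [← Finset.mul_sum, ← Finset.sum_mul, hs]
    simp [h1]
  have heD : ∀ v, e v * D = e v := by 
    intro v; ext i j
    simp only [e, D, Matrix.mul_diagonal, Matrix.single_apply]
    split_ifs with h
    · rw [← h.2, h3]
    · simp
  have hee : ∀ v, e v * e v = e v := by intro v; simp [e, h3]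
  have hee' : ∀ v w, v ≠ w → e v * e w = 0 := by
    intro v w h; simp [e, h]
  have heKe : ∀ v w, e v * K * e w = Matrix.single v w (P v * P w) := by
    intro v w
    simp only [e, Matrix.single_mul_mul_single]
    simp only [K, Matrix.of_apply]
    rw [← mul_assoc, h3, mul_assoc, h3]
  have hsum : ∑ v, e v = D := by
    ext i j
    simp only [e, D, Matrix.sum_apply, Matrix.single_apply, Matrix.diagonal_apply]
    by_cases h : i = j
    · subst h; simp
    · rw [if_neg h]
      apply Finset.sum_eq_zero
      intro v _
      rw [if_neg]
      rintro ⟨rfl, h'⟩; exact h h'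
  set R : Matrix (Fin n) (Fin n) A := D - x⁻¹ • K with hR
  have hRR : R * R = R := by
    rw [hR]
    simp only [sub_mul, mul_sub, hDD, smul_mul_assoc, mul_smul_comm, hDK, hKD, hKK, smul_smul]
    rw [inv_mul_cancel₀ hx0]; simp
  have hRD : R * D = R := by simp [hR, sub_mul, hDD, hKD]
  have heRe : ∀ v, e v * R * e v = ((x - 1) / x) • e v := by
    intro v
    have : e v * R * e v = e v * D * e v - x⁻¹ • (e v * K * e v) := by
      simp [hR, sub_mul, mul_sub]
    rw [this, heKe, heD, hee, h3, sub_div, div_self hx0, sub_smul, one_smul, one_div]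
  have heRe' : ∀ v w, v ≠ w → e v * R * e w = (-x⁻¹) • Matrix.single v w (P v * P w) := by
    intro v w h
    have : e v * R * e w = e v * D * e w - x⁻¹ • (e v * K * e w) := by
      simp [hR, sub_mul, mul_sub]
    rw [this, heKe, heD, hee' _ _ h]; simp
  set k : ℂ := x / (x - 1) with hk
  let Q : Fin n → Matrix (Fin n) (Fin n) A := fun v => k • (R * e v * R)
  have hRQ : ∀ v, R * Q v = Q v := by
    intro v; simp only [Q, mul_smul_comm, ← mul_assoc, hRR]
  have hQR : ∀ v, Q v * R = Q v := by
    intro v; simp only [Q, smul_mul_assoc, mul_assoc, hRR]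
  have hQQ : ∀ v, Q v * Q v = Q v := by
    intro v
    have : Q v * Q v = (k * k) • (R * (e v * (R * R) * e v) * R) := by
      simp only [Q, smul_mul_assoc, mul_smul_comm, smul_smul, mul_assoc]
    rw [this, hRR, heRe]
    simp only [Q, smul_mul_assoc, mul_smul_comm, smul_smul]
    congr 1; rw [hk]; field_simp
  have hQsum : ∑ v, Q v = k • R := by
    simp only [Q]
    rw [← Finset.smul_sum, ← Finset.sum_mul, ← Finset.mul_sum, hsum, hRD, hRR]
  have hτs : ∑ v, τ (P v) = x * τ r := by
    rw [← map_sum, hs, map_smul, smul_eq_mul]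
  have hσe : ∀ v, σ (e v) = τ (P v) := by
    intro v
    simp only [hσdef, e]
    rw [Finset.sum_eq_single v]
    · simp
    · intro i _ h; simp [Matrix.single, h.symm]
    · simp
  have hσR : σ R = (x - 1) * τ r := by
    have : σ R = ∑ v, τ (P v) - x⁻¹ * ∑ v, τ (P v) := by
      rw [hR, map_sub, map_smul, hσdef, hσdef]; simp [D, K, h3]
    rw [this, hτs]; field_simp
  have hσQ : ∀ v, σ (Q v) = τ (P v) := by
    intro v
    have : σ (Q v) = k * σ (e v * R * e v) := by
      simp only [Q, map_smul, smul_eq_mul]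
      rw [hσ (R * e v) R, ← mul_assoc, hRR, ← hee v, ← mul_assoc, hσ, ← mul_assoc, hee]
    rw [this, heRe, map_smul, hσe, smul_eq_mul, hk]; field_simp
  have hσQQ : ∀ v w, v ≠ w → σ (Q v * Q w) = (x - 1)⁻¹ ^ 2 * τ (P v * P w) := by
    intro v w hvw
    have e1 : σ (Q v * Q w) = k * k * σ ((e v * R * e w) * (e w * R * e v)) := by
      have e2 : Q v * Q w = (k * k) • (R * (e v * (R * R) * e w * R)) := by
        simp only [Q, smul_mul_assoc, mul_smul_comm, smul_smul, mul_assoc]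
      rw [e2, map_smul, smul_eq_mul, hRR, hσ R]
      have e3 : e v * R * e w * (e w * R * e v) = (e v * R * (e w * e w) * R) * e v := by
        simp only [mul_assoc]
      have e4 : e v * R * e w * R * R = e v * R * e w * (R * R) := by simp only [mul_assoc]
      rw [e3, hσ _ (e v), hee, e4, hRR]
      congr 2
      simp only [← mul_assoc, hee]
    rw [e1, heRe' _ _ hvw, heRe' _ _ hvw.symm]
    have e5 : σ (Matrix.single v w (P v * P w) * Matrix.single w v (P w * P v)) = τ (P v * P w) := by
      rw [Matrix.single_mul_single_same, hσdef, Finset.sum_eq_single v]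
      · simp only [Matrix.single_apply_same]
        rw [mul_assoc, ← mul_assoc (P w), h3, hτ, mul_assoc, h3, hτ]
      · intro i _ h; simp [Matrix.single, h.symm]
      · simp
    simp only [smul_mul_assoc, mul_smul_comm, map_smul, e5, smul_eq_mul, hk]
    field_simp
  obtain ⟨g1, g2⟩ := H (Matrix (Fin n) (Fin n) A) σ hσ R (fun v => R - Q v) hRR
    (by intro v; simp only [mul_sub, hRR, hRQ]) (by intro v; simp only [sub_mul, hRR, hQR])
    (by intro v; simp only [sub_mul, mul_sub, hRR, hRQ, hQR, hQQ]; simp)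
    (by rw [Finset.sum_sub_distrib, hQsum, hxy]; simp [sub_smul, Nat.cast_smul_eq_nsmul])
  have f1 : ∀ v, τ (P v) = (1 - a v) * (x - 1) * τ r := by
    intro v
    have := g1 v
    rw [map_sub, hσQ, hσR] at this
    linear_combination -this
  refine ⟨f1, ?_⟩
  intro v w
  by_cases hvw : v = w
  · subst hvw; simp only [h3, if_true]; exact f1 v
  · have := g2 v w
    simp only [sub_mul, mul_sub, hRR, hRQ, hQR, map_sub, hσQQ v w hvw] at this
    rw [hσQ, hσQ, hσR, f1, f1] at this
    simp only [if_neg hvw]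
    field_simp at this
    linear_combination this

lemma lam_step {n : ℕ} {y : ℝ} (h1 : (n : ℝ) - 1 - y ≠ 0) (h2 : (n : ℝ) - y ≠ 0)
    (H : Det n y) : Det n ((1 + 1 / ((n : ℝ) - 1 - y) : ℝ) : ℂ) := by
  have h1' : (n : ℂ) - 1 - y ≠ 0 := by exact_mod_cast h1
  have h2' : (n : ℂ) - y ≠ 0 := by exact_mod_cast h2
  refine det_step n _ y ?_ ?_ ?_ H
  · intro h
    have h : 1 + 1 / ((n : ℝ) - 1 - y) = 0 := by exact_mod_cast h
    field_simp at h
    exact h2 (by linarith)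
  · push_cast
    simpa using h1'
  · push_cast
    field_simp
    ring

lemma lam_bound {n : ℕ} (hn : 4 ≤ n) (l : ℕ) : 0 ≤ lambdaSeq n l ∧ lambdaSeq n l < 2 := by
  have hn' : (4 : ℝ) ≤ n := by exact_mod_cast hn
  induction l with
  | zero => simp [lambdaSeq]
  | succ l ih =>
    have h : 1 < (n : ℝ) - 1 - lambdaSeq n l := by linarith [ih.2]
    have h2 : 1 / ((n : ℝ) - 1 - lambdaSeq n l) < 1 := by
      rw [div_lt_one (by linarith)]; exact h
    have h3 : 0 < 1 / ((n : ℝ) - 1 - lambdaSeq n l) := by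
      apply one_div_pos.2; linarith
    simp only [lambdaSeq]
    constructor <;> linarith

lemma det_lambda {n : ℕ} (hn : 3 ≤ n) (x : ℝ) (hx : x ∈ Lambda n) : Det n x := by
  unfold Lambda at hx
  split_ifs at hx with h3
  · subst h3
    have hx : x = 3 / 2 := hx
    have := lam_step (n := 3) (y := 0) (by norm_num) (by norm_num) (by simpa using det_zero 3)
    convert this using 2
    rw [hx]; norm_num
  · obtain ⟨l, rfl⟩ := hx
    have hn4 : 4 ≤ n := by omega
    have hn' : (4 : ℝ) ≤ n := by exact_mod_cast hn4
    induction l with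
    | zero => simpa [lambdaSeq] using det_zero n
    | succ l ih =>
      have hb := lam_bound hn4 l
      exact lam_step (by linarith) (by linarith) ih

/-- matrix form of a bipartite vector -/
def mat {dA dB : ℕ} (ψ : Fin dA × Fin dB → ℂ) : Matrix (Fin dA) (Fin dB) ℂ :=
  Matrix.of fun a b => ψ (a, b)

lemma mulVec_mat {dA dB : ℕ} (ψ : Fin dA × Fin dB → ℂ) (E : Matrix (Fin dA) (Fin dA) ℂ)
    (F : Matrix (Fin dB) (Fin dB) ℂ) (a : Fin dA) (b : Fin dB) :
    (E ⊗ₖ F).mulVec ψ (a, b) = (E * mat ψ * Fᵀ) a b := by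
  simp only [Matrix.mulVec, dotProduct, Matrix.kroneckerMap_apply, Fintype.sum_prod_type,
    Matrix.mul_apply, mat, Matrix.of_apply, Matrix.transpose_apply, Finset.sum_mul]
  rw [Finset.sum_comm]
  refine Finset.sum_congr rfl fun i _ => Finset.sum_congr rfl fun j _ => ?_
  ring

lemma pinner_mat {dA dB : ℕ} (ψ : Fin dA × Fin dB → ℂ) (E : Matrix (Fin dA) (Fin dA) ℂ)
    (F : Matrix (Fin dB) (Fin dB) ℂ) :
    pinner ((E ⊗ₖ F).mulVec ψ) ψ = (E * mat ψ * Fᵀ * (mat ψ)ᴴ).trace := by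
  simp only [pinner, Fintype.sum_prod_type, mulVec_mat]
  rw [Matrix.trace]
  refine Finset.sum_congr rfl fun a _ => ?_
  rw [Matrix.diag, Matrix.mul_apply]
  rfl

lemma pinner_dot {ι : Type} [Fintype ι] (M : Matrix ι ι ℂ) (ψ : ι → ℂ) :
    pinner (M.mulVec ψ) ψ = dotProduct (star ψ) (M.mulVec ψ) := by
  simp only [pinner, dotProduct]
  refine Finset.sum_congr rfl fun i _ => ?_
  rw [mul_comm]; rfl

lemma qc_nonneg {n k : ℕ} {p : Fin n → Fin n → Fin k → Fin k → ℝ}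
    (h : IsQuantumCorrelation n k p) (v w i j) : 0 ≤ p v w i j := by
  obtain ⟨dA, dB, ψ, E, F, hψ, hE, hE1, hF, hF1, hp⟩ := h
  have h1 := ((hE v i).kronecker (hF w j)).dotProduct_mulVec_nonneg ψ
  rw [← pinner_dot, ← hp] at h1
  exact_mod_cast h1

lemma zero_mat {dA dB : ℕ} (ψ : Fin dA × Fin dB → ℂ) (E : Matrix (Fin dA) (Fin dA) ℂ)
    (F : Matrix (Fin dB) (Fin dB) ℂ) (hE : E.PosSemidef) (hF : F.PosSemidef)
    (h : pinner ((E ⊗ₖ F).mulVec ψ) ψ = 0) : E * mat ψ * Fᵀ = 0 := by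
  rw [pinner_dot, (hE.kronecker hF).dotProduct_mulVec_zero_iff] at h
  ext a b
  rw [← mulVec_mat, h]; rfl

/-- data of a synchronous strategy -/
structure SyncData {n : ℕ} (p : Fin n → Fin n → Fin 2 → Fin 2 → ℝ) where
  dA : ℕ
  dB : ℕ
  Y : Matrix (Fin dA) (Fin dB) ℂ
  E : Fin n → Matrix (Fin dA) (Fin dA) ℂ
  F : Fin n → Matrix (Fin dB) (Fin dB) ℂ
  tr1 : (Y * Yᴴ).trace = 1
  herm : ∀ v, (E v)ᴴ = E v
  comm : ∀ v, E v * Y = Y * F v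
  commR : ∀ v, E v * (Y * Yᴴ) = Y * Yᴴ * E v
  idem : ∀ v, E v * (E v * Y) = E v * Y
  p00 : ∀ v w, (p v w 0 0 : ℂ) = (E v * E w * (Y * Yᴴ)).trace
  p01 : ∀ v w, (p v w 0 1 : ℂ) = (E v * (Y * Yᴴ)).trace - (E v * E w * (Y * Yᴴ)).trace
  p10 : ∀ v w, (p v w 1 0 : ℂ) = (E w * (Y * Yᴴ)).trace - (E v * E w * (Y * Yᴴ)).trace
  p11 : ∀ v w, (p v w 1 1 : ℂ) = 1 - (E v * (Y * Yᴴ)).trace - (E w * (Y * Yᴴ)).trace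
    + (E v * E w * (Y * Yᴴ)).trace

lemma evnorm_mat {dA dB : ℕ} (ψ : Fin dA × Fin dB → ℂ) (h : evnorm ψ = 1) :
    (mat ψ * (mat ψ)ᴴ).trace = 1 := by
  have h1 : ∑ i, ‖ψ i‖ ^ 2 = 1 := by
    unfold evnorm at h
    exact Real.sqrt_eq_one.1 h
  have h2 : (mat ψ * (mat ψ)ᴴ).trace = ((∑ i, ‖ψ i‖ ^ 2 : ℝ) : ℂ) := by
    simp only [Matrix.trace, Matrix.diag, Matrix.mul_apply, Matrix.conjTranspose_apply, mat,
      Matrix.of_apply, Fintype.sum_prod_type]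
    push_cast
    refine Finset.sum_congr rfl fun i _ => Finset.sum_congr rfl fun j _ => ?_
    exact Complex.mul_conj' _
  rw [h2, h1]; simp

lemma sync_data {n : ℕ} {p : Fin n → Fin n → Fin 2 → Fin 2 → ℝ}
    (h : IsQuantumCorrelation n 2 p) (h01 : ∀ v, p v v 0 1 = 0) (h10 : ∀ v, p v v 1 0 = 0) :
    Nonempty (SyncData p) := by
  obtain ⟨dA, dB, ψ, E, F, hψ, hE, hE1, hF, hF1, hp⟩ := h
  have hE1' : ∀ v, E v 1 = 1 - E v 0 := by
    intro v; have := hE1 v; rw [Fin.sum_univ_two] at this; rw [← this]; simp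
  have hF1' : ∀ v, F v 1 = 1 - F v 0 := by
    intro v; have := hF1 v; rw [Fin.sum_univ_two] at this; rw [← this]; simp
  set Y := mat ψ with hY
  have t1 : ∀ v, E v 0 * Y = E v 0 * Y * (F v 0)ᵀ := by
    intro v
    have := zero_mat ψ _ _ (hE v 0) (hF v 1) (by rw [← hp, h01]; simp)
    rw [hF1', Matrix.transpose_sub, Matrix.transpose_one, Matrix.mul_sub, Matrix.mul_one,
      sub_eq_zero] at this
    exact this
  have t2 : ∀ v, Y * (F v 0)ᵀ = E v 0 * Y * (F v 0)ᵀ := by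
    intro v
    have := zero_mat ψ _ _ (hE v 1) (hF v 0) (by rw [← hp, h10]; simp)
    rw [hE1', Matrix.sub_mul, Matrix.sub_mul, Matrix.one_mul, sub_eq_zero] at this
    exact this
  have hc : ∀ v, E v 0 * Y = Y * (F v 0)ᵀ := fun v => (t1 v).trans (t2 v).symm
  have hEh : ∀ v, (E v 0)ᴴ = E v 0 := fun v => (hE v 0).isHermitian
  have hFh : ∀ v, ((F v 0)ᵀ)ᴴ = (F v 0)ᵀ := fun v => (hF v 0).isHermitian.transpose
  have htr := evnorm_mat ψ hψ
  rw [← hY] at htr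
  have c2 : ∀ v, (F v 0)ᵀ * Yᴴ = Yᴴ * E v 0 := by
    intro v
    have := congrArg Matrix.conjTranspose (hc v)
    rw [Matrix.conjTranspose_mul, Matrix.conjTranspose_mul, hEh, hFh] at this
    exact this.symm
  have s1 : ∀ v w, (E v 0 * Y * (F w 0)ᵀ * Yᴴ).trace = (E v 0 * E w 0 * (Y * Yᴴ)).trace := by
    intro v w
    rw [Matrix.mul_assoc (E v 0) Y, ← hc]
    simp only [Matrix.mul_assoc]
  have s2 : ∀ w, (Y * (F w 0)ᵀ * Yᴴ).trace = (E w 0 * (Y * Yᴴ)).trace := by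
    intro w
    rw [← hc, Matrix.mul_assoc]
  refine ⟨⟨dA, dB, Y, fun v => E v 0, fun v => (F v 0)ᵀ, htr, hEh, hc, ?_, ?_, ?_, ?_, ?_, ?_⟩⟩
  · intro v
    rw [← Matrix.mul_assoc, hc, Matrix.mul_assoc, c2, Matrix.mul_assoc]
  · intro v
    conv_lhs => rw [hc, ← Matrix.mul_assoc, ← t2, ← hc]
  · intro v w
    rw [hp, pinner_mat, s1]
  · intro v w
    rw [hp, pinner_mat, hF1', Matrix.transpose_sub, Matrix.transpose_one, Matrix.mul_sub,
      Matrix.sub_mul, Matrix.trace_sub, s1, Matrix.mul_one, Matrix.mul_assoc]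
  · intro v w
    rw [hp, pinner_mat, hE1', Matrix.sub_mul, Matrix.sub_mul,
      Matrix.sub_mul, Matrix.trace_sub, s1, Matrix.one_mul, s2]
  · intro v w
    rw [hp, pinner_mat, hE1', hF1', Matrix.transpose_sub, Matrix.transpose_one, ← hY]
    simp only [Matrix.mul_sub, Matrix.sub_mul, Matrix.trace_sub, Matrix.one_mul, Matrix.mul_one,
      s1, s2, htr]
    rw [Matrix.mul_assoc (E v 0)]
    ring

/-- the affine functional -/
def Lf {n : ℕ} (x : ℝ) (p : Fin n → Fin n → Fin 2 → Fin 2 → ℝ) : ℝ :=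
  ∑ v, ∑ w, p v w 0 0 - 2 * x * ∑ v, p v v 0 0 + x ^ 2

lemma Lf_eq {n : ℕ} (x : ℝ) {p : Fin n → Fin n → Fin 2 → Fin 2 → ℝ} (S : SyncData p) :
    (Lf x p : ℂ) = ((((∑ v, S.E v) - (x : ℂ) • 1) * S.Y) *
      (((∑ v, S.E v) - (x : ℂ) • 1) * S.Y)ᴴ).trace := by
  have hh : ((∑ v, S.E v) - (x : ℂ) • 1)ᴴ = (∑ v, S.E v) - (x : ℂ) • 1 := by
    simp [Matrix.conjTranspose_sum, S.herm]
  have hd : ∀ v, (S.E v * S.E v * (S.Y * S.Yᴴ)).trace = (S.E v * (S.Y * S.Yᴴ)).trace := by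
    intro v
    rw [← Matrix.mul_assoc, Matrix.mul_assoc (S.E v), S.idem, Matrix.mul_assoc]
  rw [Matrix.conjTranspose_mul, hh]
  have h1 : ∀ M : Matrix (Fin S.dA) (Fin S.dA) ℂ, (M * S.Y * (S.Yᴴ * M)).trace =
      (M * M * (S.Y * S.Yᴴ)).trace := by
    intro M
    rw [← Matrix.mul_assoc, Matrix.trace_mul_comm]
    simp only [Matrix.mul_assoc]
  rw [h1]
  have h2 : ((∑ v, S.E v) - (x : ℂ) • 1) * ((∑ v, S.E v) - (x : ℂ) • 1) =
      ∑ v, ∑ w, S.E v * S.E w - (2 * (x : ℂ)) • (∑ v, S.E v) + ((x : ℂ) ^ 2) • 1 := by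
    rw [sub_mul, mul_sub, mul_sub, Finset.sum_mul_sum]
    simp only [smul_mul_assoc, mul_smul_comm, one_mul, mul_one, smul_smul]
    module
  rw [h2]
  simp only [add_mul, sub_mul, Finset.sum_mul, smul_mul_assoc, one_mul, Matrix.trace_add,
    Matrix.trace_sub, Matrix.trace_sum, Matrix.trace_smul, S.tr1, Lf]
  push_cast
  simp only [S.p00, hd, smul_eq_mul, mul_one]

lemma Lf_nonneg {n : ℕ} (x : ℝ) {p : Fin n → Fin n → Fin 2 → Fin 2 → ℝ} (S : SyncData p) :
    0 ≤ Lf x p := by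
  have h := (Matrix.posSemidef_self_mul_conjTranspose
    (((∑ v, S.E v) - (x : ℂ) • 1) * S.Y)).trace_nonneg
  rw [← Lf_eq] at h
  exact_mod_cast h

lemma exists_ginv {m k : ℕ} (Y : Matrix (Fin m) (Fin k) ℂ) :
    ∃ G : Matrix (Fin k) (Fin m) ℂ, Y * G * Y = Y := by
  let f := Matrix.toLin' Y
  obtain ⟨g, hg⟩ := LinearMap.exists_rightInverse_of_surjective f.rangeRestrict
    f.range_rangeRestrict
  obtain ⟨g', hg'⟩ := LinearMap.exists_extend g
  refine ⟨LinearMap.toMatrix' g', ?_⟩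
  apply Matrix.toLin'.injective
  rw [Matrix.toLin'_mul, Matrix.toLin'_mul, Matrix.toLin'_toMatrix']
  apply LinearMap.ext
  intro u
  have h1 : g' (f u) = g (f.rangeRestrict u) := by
    rw [← hg']; rfl
  have h2 := LinearMap.congr_fun hg (f.rangeRestrict u)
  have h3 := congrArg Subtype.val h2
  change f (g' (f u)) = f u
  rw [h1]
  exact h3

lemma sync_det {n : ℕ} (x : ℝ) (a : Fin n → ℂ) (c : Fin n → Fin n → ℂ)
    (H : ∀ (A : Type) [Ring A] [Algebra ℂ A]
    [FiniteDimensional ℂ A] (τ : A →ₗ[ℂ] ℂ) (_ : ∀ a b, τ (a * b) = τ (b * a)) (r : A)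
    (P : Fin n → A) (_ : r * r = r) (_ : ∀ v, r * P v = P v) (_ : ∀ v, P v * r = P v)
    (_ : ∀ v, P v * P v = P v) (_ : ∑ v, P v = (x : ℂ) • r),
    (∀ v, τ (P v) = a v * τ r) ∧ ∀ v w, τ (P v * P w) = c v w * τ r)
    {p : Fin n → Fin n → Fin 2 → Fin 2 → ℝ} (S : SyncData p) (hL : Lf x p = 0) :
    (∀ v, (S.E v * (S.Y * S.Yᴴ)).trace = a v) ∧
    (∀ v w, (S.E v * S.E w * (S.Y * S.Yᴴ)).trace = c v w) := by
  have hs : (∑ v, S.E v) * S.Y = (x : ℂ) • S.Y := by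
    have h := Lf_eq x S
    rw [hL, Complex.ofReal_zero] at h
    have := Matrix.trace_mul_conjTranspose_self_eq_zero_iff.1 h.symm
    rw [Matrix.sub_mul, sub_eq_zero] at this
    simpa using this
  obtain ⟨dA, dB, Y, E, F, tr1, herm, comm, commR, idem, p00, p01, p10, p11⟩ := S
  change (∑ v, E v) * Y = (x : ℂ) • Y at hs
  change (∀ v, (E v * (Y * Yᴴ)).trace = a v) ∧ (∀ v w, (E v * E w * (Y * Yᴴ)).trace = c v w)
  clear p00 p01 p10 p11 herm
  obtain ⟨G, hG⟩ := exists_ginv Y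
  set r := Y * G with hr
  set ρ := Y * Yᴴ with hρ
  have rρ : r * ρ = ρ := by rw [hρ, ← Matrix.mul_assoc, hG]
  have rr : r * r = r := by
    conv_lhs => rw [hr, ← Matrix.mul_assoc, ← hr, hG]
  have rEY : ∀ v, r * (E v * Y) = E v * Y := by
    intro v; rw [comm, ← Matrix.mul_assoc, hG]
  have rEr : ∀ v, r * (E v * r) = E v * r := by
    intro v; rw [hr, ← Matrix.mul_assoc (E v), ← Matrix.mul_assoc, ← hr, rEY]
  let T := ρ * r
  let B := Subalgebra.centralizer ℂ ({T} : Set (Matrix (Fin dA) (Fin dA) ℂ))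
  have memB : ∀ X, X ∈ B ↔ T * X = X * T := by
    intro X; simp [B, Subalgebra.mem_centralizer_iff]
  have hrB : r ∈ B := by
    rw [memB]; simp only [T]; rw [mul_assoc, rr, ← mul_assoc, rρ]
  have hPB : ∀ v, E v * r ∈ B := by
    intro v
    rw [memB]; simp only [T]
    rw [mul_assoc, rEr, ← mul_assoc, ← commR, mul_assoc (E v) r, ← mul_assoc r, rρ, mul_assoc]
  let τ : B →ₗ[ℂ] ℂ := (Matrix.traceLinearMap (Fin dA) ℂ ℂ) ∘ₗ
    (LinearMap.mulRight ℂ T) ∘ₗ B.val.toLinearMap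
  have hτ : ∀ X : B, τ X = ((X : Matrix (Fin dA) (Fin dA) ℂ) * T).trace := fun X => rfl
  have key := H B τ (by
      intro X Z
      rw [hτ, hτ]
      have hX := (memB _).1 X.2
      simp only [Subalgebra.coe_mul]
      rw [mul_assoc, Matrix.trace_mul_comm, mul_assoc, hX, mul_assoc])
    ⟨r, hrB⟩ (fun v => ⟨E v * r, hPB v⟩)
    (Subtype.ext rr)
    (fun v => Subtype.ext (rEr v))
    (fun v => Subtype.ext (by simp only [Subalgebra.coe_mul]; rw [mul_assoc, rr]))
    (fun v => Subtype.ext (by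
      simp only [Subalgebra.coe_mul]; rw [mul_assoc, rEr, hr, ← Matrix.mul_assoc (E v) Y,
        ← Matrix.mul_assoc (E v) (E v * Y), idem]))
    (Subtype.ext (by
      simp only [AddSubmonoidClass.coe_finsetSum, Subalgebra.coe_smul]
      rw [← Finset.sum_mul, hr, ← Matrix.mul_assoc, hs, Matrix.smul_mul]))
  have v1 : τ ⟨r, hrB⟩ = 1 := by
    rw [hτ]; simp only [T]
    rw [← mul_assoc, rρ, Matrix.trace_mul_comm, rρ, tr1]
  rw [v1] at key
  simp only [mul_one] at key
  obtain ⟨k1, k2⟩ := key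
  have rEρ : ∀ v, r * (E v * ρ) = E v * ρ := by
    intro v; rw [hρ, ← Matrix.mul_assoc (E v), ← Matrix.mul_assoc, rEY]
  have rEEρ : ∀ v w, r * (E v * (E w * ρ)) = E v * (E w * ρ) := by
    intro v w
    have h1 : E v * (E w * ρ) = Y * (F v * (F w * Yᴴ)) := by
      rw [hρ, ← Matrix.mul_assoc (E w), comm, Matrix.mul_assoc Y, ← Matrix.mul_assoc (E v),
        comm, Matrix.mul_assoc Y]
    rw [h1, ← Matrix.mul_assoc r, hG]
  constructor
  · intro v
    rw [← k1 v, hτ]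
    have h1 : E v * r * T = E v * ρ * r := by
      simp only [T]
      rw [mul_assoc, ← mul_assoc r, rρ, ← mul_assoc]
    change _ = (E v * r * T).trace
    rw [h1, Matrix.trace_mul_comm (E v * ρ) r, rEρ]
  · intro v w
    rw [← k2 v w, hτ]
    have h1 : E v * r * (E w * r) * T = E v * (E w * ρ) * r := by
      simp only [T]
      rw [mul_assoc (E v) r, rEr, mul_assoc (E v), mul_assoc (E w), ← mul_assoc r, rρ,
        ← mul_assoc (E w), ← mul_assoc (E v)]
    change _ = (E v * r * (E w * r) * T).trace
    rw [h1, Matrix.trace_mul_comm _ r, rEEρ, mul_assoc]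

lemma sync_unique {n : ℕ} (x : ℝ) (hD : Det n x)
    {p q : Fin n → Fin n → Fin 2 → Fin 2 → ℝ} (S : SyncData p) (S' : SyncData q)
    (hp : Lf x p = 0) (hq : Lf x q = 0) : p = q := by
  obtain ⟨a, c, H⟩ := hD
  obtain ⟨h1, h2⟩ := sync_det x a c H S hp
  obtain ⟨h1', h2'⟩ := sync_det x a c H S' hq
  funext v w i j
  apply Complex.ofReal_injective
  fin_cases i <;> fin_cases j
  · exact (S.p00 v w).trans (by rw [h2, ← h2']; exact (S'.p00 v w).symm)
  · exact (S.p01 v w).trans (by rw [h1, h2, ← h1', ← h2']; exact (S'.p01 v w).symm)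
  · exact (S.p10 v w).trans (by rw [h1, h2, ← h1', ← h2']; exact (S'.p10 v w).symm)
  · exact (S.p11 v w).trans (by rw [h1, h1, h2, ← h1', ← h1', ← h2']; exact (S'.p11 v w).symm)

lemma proj_psd {d : ℕ} {P : Matrix (Fin d) (Fin d) ℂ} (h : IsProjection P) : P.PosSemidef := by
  have := Matrix.posSemidef_conjTranspose_mul_self P
  rwa [h.1, h.2] at this

lemma proj_compl {d : ℕ} {P : Matrix (Fin d) (Fin d) ℂ} (h : IsProjection P) :
    IsProjection (1 - P) := by
  refine ⟨by simp [h.1], ?_⟩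
  simp [sub_mul, mul_sub, h.2]

lemma proj_tr {d : ℕ} {P : Matrix (Fin d) (Fin d) ℂ} (h : IsProjection P) :
    IsProjection Pᵀ := by
  refine ⟨?_, by rw [← Matrix.transpose_mul, h.2]⟩
  exact Matrix.IsHermitian.transpose h.1

lemma canon_psd {d : ℕ} {P : Matrix (Fin d) (Fin d) ℂ} (h : IsProjection P) (i : Fin 2) :
    (canonPair P i).PosSemidef := by
  unfold canonPair
  split_ifs
  · exact proj_psd h
  · exact proj_psd (proj_compl h)

lemma canon_sum {d : ℕ} (P : Matrix (Fin d) (Fin d) ℂ) : ∑ i, canonPair P i = 1 := by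
  simp [canonPair, Fin.sum_univ_two]

lemma phid_norm {d : ℕ} (hd : 0 < d) : evnorm (phid d) = 1 := by
  have hd' : (0 : ℝ) < d := by exact_mod_cast hd
  unfold evnorm
  rw [Real.sqrt_eq_one]
  have : ∀ i : Fin d × Fin d, ‖phid d i‖ ^ 2 = if i.1 = i.2 then (d : ℝ)⁻¹ else 0 := by
    intro i
    unfold phid
    split_ifs
    · rw [Complex.norm_real, Real.norm_eq_abs, sq_abs, inv_pow, Real.sq_sqrt hd'.le]
    · simp
  simp only [this, Fintype.sum_prod_type]
  simp [hd'.ne']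

lemma phid_pinner {d : ℕ} (M N : Matrix (Fin d) (Fin d) ℂ) :
    pinner ((M ⊗ₖ Nᵀ).mulVec (phid d)) (phid d) = (d : ℂ)⁻¹ * (M * N).trace := by
  have h : mat (phid d) = (((Real.sqrt d)⁻¹ : ℝ) : ℂ) • (1 : Matrix (Fin d) (Fin d) ℂ) := by
    ext i j
    simp [mat, phid, Matrix.one_apply]
  have h2 : (((Real.sqrt d)⁻¹ : ℝ) : ℂ) * (((Real.sqrt d)⁻¹ : ℝ) : ℂ) = (d : ℂ)⁻¹ := by
    rw [← Complex.ofReal_mul, ← mul_inv, Real.mul_self_sqrt (Nat.cast_nonneg d)]; simp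
  rw [pinner_mat, h, Matrix.transpose_transpose, Matrix.conjTranspose_smul,
    Matrix.conjTranspose_one]
  simp only [Matrix.mul_smul, Matrix.smul_mul, Matrix.mul_one, Matrix.trace_smul, smul_eq_mul,
    ← h2]
  rw [← mul_assoc]
  simp

theorem statement19 {n b d : ℕ} (hn : 3 ≤ n) (x : ℝ) (hx : x ∈ Lambda n)
    (hd : 0 < d) (hcop : Nat.Coprime b d) (hbd : x = (b : ℝ) / d)
    (Pt : Fin n → Matrix (Fin d) (Fin d) ℂ)
    (hPt : ∀ v, IsProjection (Pt v)) (hPtsum : ∑ v, Pt v = (x : ℂ) • 1)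
    (pt : Fin n → Fin n → Fin 2 → Fin 2 → ℝ)
    (hpt : ∀ v w i j, (pt v w i j : ℂ) =
      pinner ((canonPair (Pt v) i ⊗ₖ canonPair ((Pt w)ᵀ) j).mulVec (phid d))
        (phid d)) :
    pt ∈ Set.extremePoints ℝ {p | IsQuantumCorrelation n 2 p} := by
  have hd' : (d : ℂ) ≠ 0 := by exact_mod_cast hd.ne'
  have hq : IsQuantumCorrelation n 2 pt :=
    ⟨d, d, phid d, fun v => canonPair (Pt v), fun w => canonPair (Pt w)ᵀ, phid_norm hd,
      fun v i => canon_psd (hPt v) i, fun v => canon_sum _,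
      fun v i => canon_psd (proj_tr (hPt v)) i, fun v => canon_sum _, hpt⟩
  have q00 : ∀ v w, (pt v w 0 0 : ℂ) = (d : ℂ)⁻¹ * (Pt v * Pt w).trace := by
    intro v w
    rw [hpt, ← phid_pinner]; simp [canonPair]
  have q01 : ∀ v, pt v v 0 1 = 0 := by
    intro v
    apply Complex.ofReal_injective
    have h1 : canonPair (Pt v)ᵀ 1 = (1 - Pt v)ᵀ := by simp [canonPair]
    have h0 : canonPair (Pt v) 0 = Pt v := by simp [canonPair]
    rw [hpt, h1, h0, phid_pinner, mul_sub, (hPt v).2]; simp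
  have q10 : ∀ v, pt v v 1 0 = 0 := by
    intro v
    apply Complex.ofReal_injective
    have h1 : canonPair (Pt v)ᵀ 0 = (Pt v)ᵀ := by simp [canonPair]
    have h0 : canonPair (Pt v) 1 = 1 - Pt v := by simp [canonPair]
    rw [hpt, h1, h0, phid_pinner, sub_mul, (hPt v).2]; simp
  have hL : Lf x pt = 0 := by
    apply Complex.ofReal_injective
    have e1 : ∑ v, ∑ w, (d : ℂ)⁻¹ * (Pt v * Pt w).trace = (x : ℂ) ^ 2 := by
      simp only [← Finset.mul_sum, ← Matrix.trace_sum, ← Finset.sum_mul, hPtsum]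
      simp [Matrix.trace_smul]
      field_simp
    have e2 : ∑ v, (d : ℂ)⁻¹ * (Pt v * Pt v).trace = (x : ℂ) := by
      simp only [(hPt _).2, ← Finset.mul_sum, ← Matrix.trace_sum, hPtsum]
      simp [Matrix.trace_smul]
      field_simp
    unfold Lf
    push_cast
    simp only [q00]
    rw [e1, e2]; ring
  obtain ⟨S⟩ := sync_data hq q01 q10
  rw [mem_extremePoints_iff_left]
  refine ⟨hq, ?_⟩
  rintro p1 hp1 p2 hp2 ⟨s, t, hs, ht, hst, hpt'⟩
  have ev : ∀ v w i j, s * p1 v w i j + t * p2 v w i j = pt v w i j := by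
    intro v w i j
    rw [← hpt']; rfl
  have z : ∀ A B : ℝ, 0 ≤ A → 0 ≤ B → s * A + t * B = 0 → A = 0 ∧ B = 0 := by
    intro A B hA hB h
    have h1 := mul_nonneg hs.le hA
    have h2 := mul_nonneg ht.le hB
    have h3 : s * A = 0 := by linarith
    have h4 : t * B = 0 := by linarith
    exact ⟨(mul_eq_zero.1 h3).resolve_left hs.ne', (mul_eq_zero.1 h4).resolve_left ht.ne'⟩
  have z01 := fun v => z _ _ (qc_nonneg hp1 v v 0 1) (qc_nonneg hp2 v v 0 1)
    ((ev v v 0 1).trans (q01 v))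
  have z10 := fun v => z _ _ (qc_nonneg hp1 v v 1 0) (qc_nonneg hp2 v v 1 0)
    ((ev v v 1 0).trans (q10 v))
  obtain ⟨S1⟩ := sync_data hp1 (fun v => (z01 v).1) (fun v => (z10 v).1)
  obtain ⟨S2⟩ := sync_data hp2 (fun v => (z01 v).2) (fun v => (z10 v).2)
  have hLc : s * Lf x p1 + t * Lf x p2 = 0 := by
    rw [← hL]
    unfold Lf
    simp only [← ev, Finset.sum_add_distrib, ← Finset.mul_sum]
    have : t = 1 - s := by linarith
    rw [this]; ring
  have hz := z _ _ (Lf_nonneg x S1) (Lf_nonneg x S2) hLc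
  exact sync_unique x (det_lambda hn x hx) S1 S hz.1 hL

end QST
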